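/- Let G be a finite simple d-regular graph on vertex set V, and let k ≥ 1 be an integer. Then G contains a clique of size k if and only if there exists a nonempty set S ⊆ V with |S| ≤ k such that, as integers, |E(S, V∖S)| ≤ (d − k + 1)·|S|. (Equivalently, G has a k-clique if and only if ψ_k(G) ≤ d − k + 1.) -/

import Mathlib

open Finset

/-- The number of edges of `G` with one endpoint in `S` and the other in `T`. -/
def cutE {V : Type*} [Fintype V] [DecidableEq V] (G : SimpleGraph V) [DecidableRel G.Adj]
    (S T : Finset V) : ℕ :=
  (G.edgeFinset.filter (fun e => ∃ a ∈ S, ∃ b ∈ T, e = s(a, b))).card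

section CliqueExpansion

variable {V : Type*} [Fintype V] [DecidableEq V] (G : SimpleGraph V) [DecidableRel G.Adj]

lemma cutE_compl_eq_sum (S : Finset V) :
    cutE G S Sᶜ = ∑ v ∈ S, (G.neighborFinset v \ S).card := by
  rw [← Finset.card_sigma]
  symm
  refine Finset.card_bij (fun p _ => s(p.1, p.2)) ?_ ?_ ?_
  · rintro ⟨a, b⟩ h
    simp only [mem_sigma, mem_sdiff, SimpleGraph.mem_neighborFinset] at h
    simp only [mem_filter, SimpleGraph.mem_edgeFinset, SimpleGraph.mem_edgeSet]
    exact ⟨h.2.1, a, h.1, b, by simpa using h.2.2, rfl⟩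
  · rintro ⟨a, b⟩ h ⟨a', b'⟩ h' heq
    simp only [mem_sigma, mem_sdiff] at h h'
    rcases Sym2.eq_iff.1 heq with ⟨h₁, h₂⟩ | ⟨h₁, h₂⟩
    · simp only at h₁ h₂
      subst h₁ h₂
      rfl
    · simp only at h₁
      exact absurd (h₁ ▸ h.1) h'.2.2
  · intro e he
    simp only [mem_filter, SimpleGraph.mem_edgeFinset] at he
    obtain ⟨hadj, a, ha, b, hb, rfl⟩ := he
    refine ⟨⟨a, b⟩, ?_, rfl⟩
    simp only [mem_sigma, mem_sdiff, SimpleGraph.mem_neighborFinset]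
    exact ⟨ha, hadj, by simpa using hb⟩

lemma cutE_compl_add_sum_inter {d : ℕ} (hreg : ∀ v, G.degree v = d) (S : Finset V) :
    cutE G S Sᶜ + ∑ v ∈ S, (G.neighborFinset v ∩ S).card = d * S.card := by
  rw [cutE_compl_eq_sum, ← Finset.sum_add_distrib,
    Finset.sum_congr rfl fun v _ => by
      rw [card_sdiff_add_card_inter, G.card_neighborFinset_eq_degree, hreg v],
    Finset.sum_const, smul_eq_mul, mul_comm]

lemma neighborFinset_inter_subset_erase (S : Finset V) (v : V) :
    G.neighborFinset v ∩ S ⊆ S.erase v := by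
  intro w hw
  rw [mem_inter, SimpleGraph.mem_neighborFinset] at hw
  exact mem_erase.2 ⟨hw.1.ne', hw.2⟩

lemma isClique_iff_card_neighborFinset_inter (S : Finset V) :
    G.IsClique (S : Set V) ↔ ∀ v ∈ S, (G.neighborFinset v ∩ S).card = S.card - 1 := by
  constructor
  · intro h v hv
    rw [← card_erase_of_mem hv]
    congr 1
    refine (neighborFinset_inter_subset_erase G S v).antisymm fun w hw => ?_
    rw [mem_erase] at hw
    exact mem_inter.2 ⟨(G.mem_neighborFinset v w).2 (h hv hw.2 hw.1.symm), hw.2⟩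
  · intro h v hv w hw hne
    have heq := eq_of_subset_of_card_le (neighborFinset_inter_subset_erase G S v)
      (by rw [card_erase_of_mem hv, h v hv])
    have hmem : w ∈ G.neighborFinset v ∩ S := heq ▸ mem_erase.2 ⟨hne.symm, hw⟩
    exact (G.mem_neighborFinset v w).1 (mem_inter.1 hmem).1

end CliqueExpansion

/-- In a `d`-regular graph, there is a clique of size `k` if and only if there is a
nonempty set `S` with `|S| ≤ k` and `|E(S, V∖S)| ≤ (d − k + 1)·|S|` (as integers). -/
theorem stmt_7 {V : Type*} [Fintype V] [DecidableEq V] (G : SimpleGraph V) [DecidableRel G.Adj]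
    (d : ℕ) (hreg : ∀ v : V, G.degree v = d) (k : ℕ) (hk : 1 ≤ k) :
    (∃ S : Finset V, G.IsNClique k S) ↔
      (∃ S : Finset V, S.Nonempty ∧ S.card ≤ k ∧
        (cutE G S Sᶜ : ℤ) ≤ ((d : ℤ) - k + 1) * S.card) := by
  constructor
  · rintro ⟨S, hS⟩
    have hcard := hS.card_eq
    refine ⟨S, card_pos.1 (by omega), hcard.le, ?_⟩
    have hsum := cutE_compl_add_sum_inter G hreg S
    rw [Finset.sum_congr rfl ((isClique_iff_card_neighborFinset_inter G S).1 hS.isClique),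
      Finset.sum_const, smul_eq_mul, hcard] at hsum
    zify [hk] at hsum
    rw [hcard]
    linarith
  · rintro ⟨S, hne, hle, hcut⟩
    have hpos := hne.card_pos
    have hsum := cutE_compl_add_sum_inter G hreg S
    have hbound : ∀ v ∈ S, (G.neighborFinset v ∩ S).card ≤ S.card - 1 := fun v hv =>
      (card_le_card (neighborFinset_inter_subset_erase G S v)).trans_eq (card_erase_of_mem hv)
    have hlower : (k - 1) * S.card ≤ ∑ v ∈ S, (G.neighborFinset v ∩ S).card := by
      zify [hk] at hsum ⊢
      linarith
    have hupper := Finset.sum_le_sum hbound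
    rw [Finset.sum_const, smul_eq_mul, mul_comm] at hupper
    have hk_le : k - 1 ≤ S.card - 1 := Nat.le_of_mul_le_mul_right (hlower.trans hupper) hpos
    have hcard : S.card = k := by omega
    refine ⟨S, (isClique_iff_card_neighborFinset_inter G S).2 ?_, hcard⟩
    refine (Finset.sum_eq_sum_iff_of_le hbound).1 ?_
    rw [Finset.sum_const, smul_eq_mul, mul_comm]
    refine le_antisymm hupper ?_
    rwa [← hcard] at hlower
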